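/- (Fourier transform of Gaussian-weighted Hermite polynomials.) Let n ∈ ℕ, r > 0 and 0 < α < r². Then for all real ω: (2π)^{-1/2} ∫_ℝ e^{-α x²} H_n(r x) e^{i ω x} dx = (2α)^{-1/2} · exp(-ω²/(4α)) · iⁿ · ((r² - α)/α)^{n/2} · H_n( r ω / √(4α(r² - α)) ). -/

import Mathlib

open MeasureTheory Real

/-- The physicists' Hermite polynomials: `H_0(x)=1`, `H_1(x)=2x`,
`H_{n+1}(x) = 2x H_n(x) - 2n H_{n-1}(x)`. -/
noncomputable def hermiteH : ℕ → ℝ → ℝ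
  | 0, _ => 1
  | 1, x => 2 * x
  | n + 2, x => 2 * x * hermiteH (n + 1) x - 2 * (n + 1) * hermiteH n x

theorem hasDerivAt_hermiteH_succ (n : ℕ) (x : ℝ) :
    HasDerivAt (hermiteH (n + 1)) (2 * (n + 1) * hermiteH n x) x := by
  induction n using Nat.twoStepInduction generalizing x with
  | zero =>
    have h := (hasDerivAt_id x).const_mul 2
    exact h.congr_deriv (by simp [hermiteH])
  | one =>
    have h := (((hasDerivAt_id x).const_mul 2).mul ((hasDerivAt_id x).const_mul 2)).sub
      (hasDerivAt_const x 2)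
    have hf : hermiteH (1 + 1) = (fun y => 2 * id y) * (fun y => 2 * id y) - fun _ => 2 := by
      ext y
      simp [hermiteH]
    rw [hf]
    refine h.congr_deriv ?_
    simp [hermiteH]
    ring
  | more n ih₀ ih₁ =>
    have h := (((hasDerivAt_id x).const_mul 2).mul (ih₁ x)).sub
      ((ih₀ x).const_mul (2 * ((n : ℝ) + 2)))
    have hf : hermiteH (n + 2 + 1) = (fun y => 2 * id y) * hermiteH (n + 1 + 1) -
        fun y => 2 * ((n : ℝ) + 2) * hermiteH (n + 1) y := by
      ext y
      simp only [hermiteH, Pi.sub_apply, Pi.mul_apply, id]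
      push_cast
      ring
    rw [hf]
    refine h.congr_deriv ?_
    simp only [hermiteH, id]
    push_cast
    ring

theorem integrable_pow_mul_cexp_neg_mul_sq_mul_cexp {α : ℝ} (hα : 0 < α) (ω : ℝ) (k : ℕ) :
    Integrable fun x : ℝ => (x : ℂ) ^ k *
      (Complex.exp (-(α : ℂ) * (x : ℂ) ^ 2) * Complex.exp (Complex.I * (ω : ℂ) * (x : ℂ))) := by
  have h := integrable_rpow_mul_exp_neg_mul_sq hα (s := k)
    (lt_of_lt_of_le neg_one_lt_zero k.cast_nonneg)
  refine h.norm.mono' (by fun_prop) (ae_of_all _ fun x => le_of_eq ?_)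
  simp only [norm_mul, norm_pow, Complex.norm_exp, Real.rpow_natCast, Complex.norm_real,
    Real.norm_eq_abs, Real.abs_exp]
  have h₁ : (-(α : ℂ) * (x : ℂ) ^ 2).re = -α * x ^ 2 := by
    rw [← Complex.ofReal_re (-α * x ^ 2)]
    push_cast
    rfl
  have h₂ : (Complex.I * (ω : ℂ) * (x : ℂ)).re = 0 := by simp
  rw [h₁, h₂, Real.exp_zero, mul_one]

theorem integrable_pow_mul_hermiteH_mul_cexp {α : ℝ} (hα : 0 < α) (r ω : ℝ) (n k : ℕ) :
    Integrable fun x : ℝ => (x : ℂ) ^ k *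
      (Complex.exp (-(α : ℂ) * (x : ℂ) ^ 2) * ((hermiteH n (r * x) : ℝ) : ℂ) *
        Complex.exp (Complex.I * (ω : ℂ) * (x : ℂ))) := by
  induction n using Nat.twoStepInduction generalizing k with
  | zero =>
    refine (integrable_pow_mul_cexp_neg_mul_sq_mul_cexp hα ω k).congr (ae_of_all _ fun x => ?_)
    simp [hermiteH]
  | one =>
    refine ((integrable_pow_mul_cexp_neg_mul_sq_mul_cexp hα ω (k + 1)).const_mul
      (2 * r : ℂ)).congr (ae_of_all _ fun x => ?_)
    simp only [hermiteH]
    push_cast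
    ring
  | more n ih₀ ih₁ =>
    refine (((ih₁ (k + 1)).const_mul (2 * r : ℂ)).sub
      ((ih₀ k).const_mul (2 * (n + 1) : ℂ))).congr (ae_of_all _ fun x => ?_)
    simp only [hermiteH, Pi.sub_apply]
    push_cast
    ring

/-- The integral `∫ e^{-αx²} H_n(rx) e^{iωx} dx`. -/
noncomputable def hermiteGaussianIntegral (r α ω : ℝ) (n : ℕ) : ℂ :=
  ∫ x : ℝ, Complex.exp (-(α : ℂ) * (x : ℂ) ^ 2) * ((hermiteH n (r * x) : ℝ) : ℂ) *
    Complex.exp (Complex.I * (ω : ℂ) * (x : ℂ))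

theorem hasDerivAt_cexp_mul_hermiteH_mul_cexp (r α ω x d : ℝ) (n : ℕ)
    (hd : HasDerivAt (hermiteH n) d (r * x)) :
    HasDerivAt (fun x : ℝ => Complex.exp (-(α : ℂ) * (x : ℂ) ^ 2) *
        ((hermiteH n (r * x) : ℝ) : ℂ) * Complex.exp (Complex.I * (ω : ℂ) * (x : ℂ)))
      ((Complex.I * ω) * (Complex.exp (-(α : ℂ) * (x : ℂ) ^ 2) *
          ((hermiteH n (r * x) : ℝ) : ℂ) * Complex.exp (Complex.I * (ω : ℂ) * (x : ℂ))) -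
        (2 * α) * ((x : ℂ) ^ 1 * (Complex.exp (-(α : ℂ) * (x : ℂ) ^ 2) *
          ((hermiteH n (r * x) : ℝ) : ℂ) * Complex.exp (Complex.I * (ω : ℂ) * (x : ℂ)))) +
        r * (Complex.exp (-(α : ℂ) * (x : ℂ) ^ 2) * (d : ℂ) *
          Complex.exp (Complex.I * (ω : ℂ) * (x : ℂ)))) x := by
  have hx : HasDerivAt (fun x : ℝ => (x : ℂ)) 1 x := (hasDerivAt_id x).ofReal_comp
  have h₁ := ((hx.pow 2).const_mul (-(α : ℂ))).cexp
  have h₂ := (hd.comp x ((hasDerivAt_id x).const_mul r)).ofReal_comp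
  have h₃ := (hx.const_mul (Complex.I * (ω : ℂ))).cexp
  refine ((h₁.mul h₂).mul h₃).congr_deriv ?_
  simp only [Pi.mul_apply, Pi.pow_apply, Function.comp_apply]
  push_cast
  ring

theorem integral_id_mul_cexp_mul_hermiteH_mul_cexp {α : ℝ} (hα : 0 < α) (r ω : ℝ) (n : ℕ) :
    (2 * α : ℂ) * ∫ x : ℝ, (x : ℂ) ^ 1 * (Complex.exp (-(α : ℂ) * (x : ℂ) ^ 2) *
        ((hermiteH n (r * x) : ℝ) : ℂ) * Complex.exp (Complex.I * (ω : ℂ) * (x : ℂ))) =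
      Complex.I * ω * hermiteGaussianIntegral r α ω n +
        2 * n * r * hermiteGaussianIntegral r α ω (n - 1) := by
  have hd (y : ℝ) : HasDerivAt (hermiteH n) (2 * n * hermiteH (n - 1) y) y := by
    cases n with
    | zero =>
      have h : hermiteH 0 = fun _ => 1 := by ext; simp [hermiteH]
      simpa [h] using hasDerivAt_const y (1 : ℝ)
    | succ n => simpa using hasDerivAt_hermiteH_succ n y
  have h_int (m : ℕ) : Integrable fun x : ℝ => Complex.exp (-(α : ℂ) * (x : ℂ) ^ 2) *
      ((hermiteH m (r * x) : ℝ) : ℂ) * Complex.exp (Complex.I * (ω : ℂ) * (x : ℂ)) := by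
    simpa using integrable_pow_mul_hermiteH_mul_cexp hα r ω m 0
  have h₁ := (h_int n).const_mul (Complex.I * ω)
  have h₂ := (integrable_pow_mul_hermiteH_mul_cexp hα r ω n 1).const_mul (2 * α : ℂ)
  have h₃ := (h_int (n - 1)).const_mul (2 * n * r : ℂ)
  have h₁₂ : Integrable fun x : ℝ => Complex.I * ω * (Complex.exp (-(α : ℂ) * (x : ℂ) ^ 2) *
          ((hermiteH n (r * x) : ℝ) : ℂ) * Complex.exp (Complex.I * (ω : ℂ) * (x : ℂ))) -
        (2 * α) * ((x : ℂ) ^ 1 * (Complex.exp (-(α : ℂ) * (x : ℂ) ^ 2) *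
          ((hermiteH n (r * x) : ℝ) : ℂ) * Complex.exp (Complex.I * (ω : ℂ) * (x : ℂ)))) :=
    h₁.sub h₂
  have h := integral_eq_zero_of_hasDerivAt_of_integrable
    (fun x => (hasDerivAt_cexp_mul_hermiteH_mul_cexp r α ω x _ n (hd (r * x))).congr_deriv
      (g' := Complex.I * ω * (Complex.exp (-(α : ℂ) * (x : ℂ) ^ 2) *
          ((hermiteH n (r * x) : ℝ) : ℂ) * Complex.exp (Complex.I * (ω : ℂ) * (x : ℂ))) -
        (2 * α) * ((x : ℂ) ^ 1 * (Complex.exp (-(α : ℂ) * (x : ℂ) ^ 2) *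
          ((hermiteH n (r * x) : ℝ) : ℂ) * Complex.exp (Complex.I * (ω : ℂ) * (x : ℂ)))) +
        2 * n * r * (Complex.exp (-(α : ℂ) * (x : ℂ) ^ 2) *
          ((hermiteH (n - 1) (r * x) : ℝ) : ℂ) * Complex.exp (Complex.I * (ω : ℂ) * (x : ℂ))))
      (by push_cast; ring)) (h₁₂.add h₃) (h_int n)
  rw [integral_add h₁₂ h₃, integral_sub h₁ h₂, integral_const_mul, integral_const_mul,
    integral_const_mul] at h
  unfold hermiteGaussianIntegral
  linear_combination -h

theorem hermiteGaussianIntegral_zero {α : ℝ} (hα : 0 < α) (r ω : ℝ) :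
    hermiteGaussianIntegral r α ω 0 =
      (π / α : ℂ) ^ (1 / 2 : ℂ) * Complex.exp (-(ω : ℂ) ^ 2 / (4 * (α : ℂ))) := by
  rw [← fourierIntegral_gaussian (b := (α : ℂ)) (by simpa using hα)]
  refine integral_congr_ae (ae_of_all _ fun x => ?_)
  simp [hermiteH, mul_comm]

theorem hermiteGaussianIntegral_one {α : ℝ} (hα : 0 < α) (r ω : ℝ) :
    hermiteGaussianIntegral r α ω 1 =
      Complex.I * (r * ω / α : ℂ) * hermiteGaussianIntegral r α ω 0 := by
  have h := integral_id_mul_cexp_mul_hermiteH_mul_cexp hα r ω 0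
  have hα' : (α : ℂ) ≠ 0 := by exact_mod_cast hα.ne'
  have h₁ : hermiteGaussianIntegral r α ω 1 = 2 * r * ∫ x : ℝ, (x : ℂ) ^ 1 *
      (Complex.exp (-(α : ℂ) * (x : ℂ) ^ 2) *
        ((hermiteH 0 (r * x) : ℝ) : ℂ) * Complex.exp (Complex.I * (ω : ℂ) * (x : ℂ))) := by
    rw [← integral_const_mul]
    refine integral_congr_ae (ae_of_all _ fun x => ?_)
    simp only [hermiteH]
    push_cast
    ring
  rw [h₁]
  generalize (∫ x : ℝ, (x : ℂ) ^ 1 * _ : ℂ) = J at h ⊢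
  field_simp
  push_cast at h
  linear_combination (r : ℂ) * h

theorem hermiteGaussianIntegral_add_two {α : ℝ} (hα : 0 < α) (r ω : ℝ) (n : ℕ) :
    hermiteGaussianIntegral r α ω (n + 2) =
      Complex.I * (r * ω / α : ℂ) * hermiteGaussianIntegral r α ω (n + 1) +
        2 * (n + 1) * ((r ^ 2 - α) / α : ℂ) * hermiteGaussianIntegral r α ω n := by
  have h := integral_id_mul_cexp_mul_hermiteH_mul_cexp hα r ω (n + 1)
  have hα' : (α : ℂ) ≠ 0 := by exact_mod_cast hα.ne'
  have h₁ : hermiteGaussianIntegral r α ω (n + 2) = 2 * r * (∫ x : ℝ, (x : ℂ) ^ 1 *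
      (Complex.exp (-(α : ℂ) * (x : ℂ) ^ 2) *
        ((hermiteH (n + 1) (r * x) : ℝ) : ℂ) * Complex.exp (Complex.I * (ω : ℂ) * (x : ℂ)))) -
      2 * (n + 1) * hermiteGaussianIntegral r α ω n := by
    have h_int : Integrable fun x : ℝ => Complex.exp (-(α : ℂ) * (x : ℂ) ^ 2) *
        ((hermiteH n (r * x) : ℝ) : ℂ) * Complex.exp (Complex.I * (ω : ℂ) * (x : ℂ)) := by
      simpa using integrable_pow_mul_hermiteH_mul_cexp hα r ω n 0
    unfold hermiteGaussianIntegral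
    rw [← integral_const_mul, ← integral_const_mul, ← integral_sub
      ((integrable_pow_mul_hermiteH_mul_cexp hα r ω (n + 1) 1).const_mul _)
      (h_int.const_mul _)]
    refine integral_congr_ae (ae_of_all _ fun x => ?_)
    simp only [hermiteH]
    push_cast
    ring
  rw [h₁]
  generalize (∫ x : ℝ, (x : ℂ) ^ 1 * _ : ℂ) = J at h ⊢
  field_simp
  rw [Nat.add_sub_cancel] at h
  push_cast at h
  linear_combination (r : ℂ) * h

theorem hermiteGaussianIntegral_eq {r α : ℝ} (hα : 0 < α) (hαr : α < r ^ 2) (ω : ℝ) (n : ℕ) :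
    hermiteGaussianIntegral r α ω n = hermiteGaussianIntegral r α ω 0 *
      (Complex.I ^ n * ((√((r ^ 2 - α) / α) ^ n : ℝ) : ℂ) *
        ((hermiteH n (r * ω / √(4 * α * (r ^ 2 - α))) : ℝ) : ℂ)) := by
  have hβ : 0 < r ^ 2 - α := sub_pos.mpr hαr
  have hc : ((√((r ^ 2 - α) / α) : ℝ) : ℂ) ^ 2 = (r ^ 2 - α) / α := by
    have := Real.sq_sqrt (div_pos hβ hα).le
    exact_mod_cast this
  have hy : ((√((r ^ 2 - α) / α) : ℝ) : ℂ) *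
      (2 * ((r * ω / √(4 * α * (r ^ 2 - α)) : ℝ) : ℂ)) = r * ω / α := by
    have h₀ : √(4 * α * (r ^ 2 - α)) = 2 * α * √((r ^ 2 - α) / α) := by
      rw [Real.sqrt_eq_iff_mul_self_eq (by positivity) (by positivity), eq_comm]
      have := Real.mul_self_sqrt (div_pos hβ hα).le
      calc 2 * α * √((r ^ 2 - α) / α) * (2 * α * √((r ^ 2 - α) / α))
          = 4 * α ^ 2 * (√((r ^ 2 - α) / α) * √((r ^ 2 - α) / α)) := by ring
        _ = 4 * α * (r ^ 2 - α) := by rw [this]; field_simp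
    have hs : √((r ^ 2 - α) / α) ≠ 0 := (Real.sqrt_pos.mpr (div_pos hβ hα)).ne'
    have : √((r ^ 2 - α) / α) * (2 * (r * ω / √(4 * α * (r ^ 2 - α)))) = r * ω / α := by
      rw [h₀]
      generalize √((r ^ 2 - α) / α) = c at hs
      field_simp
    exact_mod_cast this
  generalize r * ω / √(4 * α * (r ^ 2 - α)) = y at hy
  generalize √((r ^ 2 - α) / α) = c at hc hy
  induction n using Nat.twoStepInduction with
  | zero => simp [hermiteH]
  | one =>
    rw [hermiteGaussianIntegral_one hα, ← hy]
    simp only [hermiteH]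
    push_cast
    ring
  | more n ih₀ ih₁ =>
    rw [hermiteGaussianIntegral_add_two hα, ih₀, ih₁, ← hy, ← hc]
    simp only [hermiteH]
    push_cast
    linear_combination (-2 * (n + 1) * hermiteGaussianIntegral r α ω 0 * Complex.I ^ n *
      (c : ℂ) ^ (n + 2) * (hermiteH n y : ℂ)) * (-Complex.I_sq)

/-- **Fourier transform of Gaussian-weighted Hermite polynomials.**
For `n ∈ ℕ`, `r > 0` and `0 < α < r²`, and every real `ω`:
`(2π)^{-1/2} ∫ e^{-αx²} H_n(rx) e^{iωx} dx
  = (2α)^{-1/2} e^{-ω²/(4α)} iⁿ ((r²-α)/α)^{n/2} H_n(rω/√(4α(r²-α)))`. -/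
theorem statement_6 (n : ℕ) (r α : ℝ) (hr : 0 < r) (hα : 0 < α) (hαr : α < r ^ 2)
    (ω : ℝ) :
    (((2 * π) ^ (-(1 : ℝ) / 2) : ℝ) : ℂ) *
      ∫ x : ℝ, Complex.exp (-(α : ℂ) * (x : ℂ) ^ 2) * ((hermiteH n (r * x) : ℝ) : ℂ) *
        Complex.exp (Complex.I * (ω : ℂ) * (x : ℂ)) =
    (((2 * α) ^ (-(1 : ℝ) / 2) : ℝ) : ℂ) *
      Complex.exp (-(ω : ℂ) ^ 2 / (4 * (α : ℂ))) * Complex.I ^ n *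
      (((((r ^ 2 - α) / α) ^ ((n : ℝ) / 2) : ℝ)) : ℂ) *
      ((hermiteH n (r * ω / Real.sqrt (4 * α * (r ^ 2 - α))) : ℝ) : ℂ) := by
  have h_pi : (((2 * π) ^ (-(1 : ℝ) / 2) : ℝ) : ℂ) * (π / α : ℂ) ^ (1 / 2 : ℂ) =
      (((2 * α) ^ (-(1 : ℝ) / 2) : ℝ) : ℂ) := by
    have h : (2 * π) ^ (-(1 : ℝ) / 2) * (π / α) ^ (1 / 2 : ℝ) = (2 * α) ^ (-(1 : ℝ) / 2) := by
      rw [neg_div, Real.rpow_neg (by positivity), Real.rpow_neg (by positivity),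
        ← Real.inv_rpow (by positivity), ← Real.inv_rpow (by positivity),
        ← Real.mul_rpow (by positivity) (by positivity)]
      congr 1
      field_simp
    rw [← h, Complex.ofReal_mul, Complex.ofReal_cpow (x := π / α) (by positivity)]
    push_cast
    rfl
  have h_pow : ((r ^ 2 - α) / α) ^ ((n : ℝ) / 2) = √((r ^ 2 - α) / α) ^ n := by
    rw [Real.sqrt_eq_rpow, ← Real.rpow_mul_natCast (div_pos (sub_pos.mpr hαr) hα).le]
    congr 1
    ring
  have h := hermiteGaussianIntegral_eq hα hαr ω n
  rw [hermiteGaussianIntegral_zero hα] at h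
  rw [← hermiteGaussianIntegral, h, h_pow, ← h_pi]
  ring
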